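/- Every operator convex function f : (0,∞) → ℝ is differentiable, and for each t₀ > 0 the function g(t) = (f(t) − f(t₀))/(t − t₀) for t ≠ t₀, g(t₀) = f'(t₀), is operator monotone on (0,∞). -/

import Mathlib

open Matrix Set
open scoped ComplexOrder

noncomputable section

/-- `f` is `n`-matrix monotone on `I`. -/
def MatMonoOn (n : ℕ) (I : Set ℝ) (f : ℝ → ℝ) : Prop :=
  ∀ (A B : Matrix (Fin n) (Fin n) ℂ) (hA : A.IsHermitian) (hB : B.IsHermitian),
    (∀ i, hA.eigenvalues i ∈ I) → (∀ i, hB.eigenvalues i ∈ I) →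
    (B - A).PosSemidef → (hB.cfc f - hA.cfc f).PosSemidef

/-- `f` is `n`-matrix concave on `I`. -/
def MatConcaveOn (n : ℕ) (I : Set ℝ) (f : ℝ → ℝ) : Prop :=
  ∀ (A B : Matrix (Fin n) (Fin n) ℂ) (hA : A.IsHermitian) (hB : B.IsHermitian)
    (s : ℝ), s ∈ Icc (0:ℝ) 1 →
    (∀ i, hA.eigenvalues i ∈ I) → (∀ i, hB.eigenvalues i ∈ I) →
    ∀ (hC : ((s:ℂ) • A + ((1:ℂ) - (s:ℂ)) • B).IsHermitian),
      (hC.cfc f - ((s:ℂ) • hA.cfc f + ((1:ℂ) - (s:ℂ)) • hB.cfc f)).PosSemidef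

/-- `f` is `n`-matrix convex on `I`. -/
def MatConvexOn (n : ℕ) (I : Set ℝ) (f : ℝ → ℝ) : Prop :=
  ∀ (A B : Matrix (Fin n) (Fin n) ℂ) (hA : A.IsHermitian) (hB : B.IsHermitian)
    (s : ℝ), s ∈ Icc (0:ℝ) 1 →
    (∀ i, hA.eigenvalues i ∈ I) → (∀ i, hB.eigenvalues i ∈ I) →
    ∀ (hC : ((s:ℂ) • A + ((1:ℂ) - (s:ℂ)) • B).IsHermitian),
      (((s:ℂ) • hA.cfc f + ((1:ℂ) - (s:ℂ)) • hB.cfc f) - hC.cfc f).PosSemidef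

/-- First divided difference. -/
def dd (f : ℝ → ℝ) (t s : ℝ) : ℝ :=
  if t = s then deriv f t else (f t - f s) / (t - s)

/-- Second divided difference. -/
def dd2 (f : ℝ → ℝ) (t s r : ℝ) : ℝ :=
  if t = s then
    (if s = r then deriv (deriv f) t / 2 else (deriv f t - dd f t r) / (t - r))
  else if t = r then (deriv f t - dd f t s) / (t - s)
  else (dd f t s - dd f s r) / (t - r)

section

open Filter Topology

variable {n : Type*} [Fintype n] [DecidableEq n]

theorem dd_spec (F : ℝ → ℝ) (t c : ℝ) : F t = F c + (t - c) * dd F t c := by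
  unfold dd
  split_ifs with h
  · simp [h]
  · field_simp [sub_ne_zero.mpr h]
    ring

theorem continuousOn_spectrum (F : ℝ → ℝ) (A : Matrix n n ℂ) :
    ContinuousOn F (spectrum ℝ A) :=
  A.finite_real_spectrum.continuousOn F

theorem cfc_eq_add_sub_mul (F : ℝ → ℝ) (c : ℝ) {A : Matrix n n ℂ} (hA : A.IsHermitian) :
    cfc F A = algebraMap ℝ _ (F c) +
      (A - algebraMap ℝ _ c) * cfc (fun t => dd F t c) A := by
  have hA' : IsSelfAdjoint A := hA
  have h : cfc F A = cfc (fun t => F c + (t - c) * dd F t c) A :=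
    cfc_congr fun t _ => dd_spec F t c
  rw [h, cfc_const_add _ _ _ (continuousOn_spectrum _ _),
    cfc_mul _ _ _ (continuousOn_spectrum _ _) (continuousOn_spectrum _ _),
    cfc_sub _ _ _ (continuousOn_spectrum _ _) (continuousOn_spectrum _ _), cfc_id' ℝ A,
    cfc_const c A]

omit [Fintype n] in
theorem isHermitian_diagonal_ofReal (l : n → ℝ) :
    (diagonal fun i => (l i : ℂ)).IsHermitian := by
  ext i j
  by_cases h : i = j
  · subst h; simp
  · simp [h, Ne.symm h]

theorem cfc_diagonal (F : ℝ → ℝ) (l : n → ℝ) :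
    cfc F (diagonal fun i => (l i : ℂ)) = diagonal fun i => (F (l i) : ℂ) := by
  ext i k
  rw [cfc_eq_add_sub_mul F (l i) (isHermitian_diagonal_ofReal l)]
  simp only [Matrix.add_apply, Matrix.sub_mul, Matrix.sub_apply, diagonal_mul,
    Matrix.algebraMap_eq_diagonal, diagonal_apply]
  simp

/-- Row formula for the functional calculus at a perturbed diagonal matrix. -/
theorem cfc_diagonal_add_apply (F : ℝ → ℝ) (l : n → ℝ) {K : Matrix n n ℂ} (hK : K.IsHermitian)
    (e : ℝ) (i k : n) :
    (cfc F ((diagonal fun i => (l i : ℂ)) + e • K) - cfc F (diagonal fun i => (l i : ℂ))) i k =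
      e * (K * cfc (fun t => dd F t (l i)) ((diagonal fun i => (l i : ℂ)) + e • K)) i k := by
  have hY : ((diagonal fun i => (l i : ℂ)) + e • K).IsHermitian :=
    (isHermitian_diagonal_ofReal l).add (hK.smul (k := e) (IsSelfAdjoint.all e))
  rw [cfc_eq_add_sub_mul F (l i) hY, cfc_diagonal]
  simp only [Matrix.add_apply, Matrix.sub_mul, Matrix.add_mul, smul_mul,
    Matrix.sub_apply, diagonal_mul, Matrix.algebraMap_eq_diagonal, diagonal_apply]
  simp

open scoped Matrix.Norms.L2Operator in
theorem continuousOn_cfc_posDef {X : Type*} [TopologicalSpace X] {F : ℝ → ℝ}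
    (hF : ContinuousOn F (Ioi 0)) {A : X → Matrix n n ℂ} {s : Set X} (hA : ContinuousOn A s)
    (hs : ∀ x ∈ s, (A x).PosDef) : ContinuousOn (fun x => cfc F (A x)) s := by
  refine ContinuousOn.cfc_of_mem_nhdsSet (s := Ioi 0) F ?_ hA (fun x hx => (hs x hx).isHermitian) hF
  rw [isOpen_Ioi.mem_nhdsSet]
  refine iUnion₂_subset fun x hx => ?_
  rw [(hs x hx).isHermitian.spectrum_real_eq_range_eigenvalues]
  rintro _ ⟨i, rfl⟩
  exact (hs x hx).eigenvalues_pos i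

open scoped Matrix.Norms.L2Operator in
theorem eventually_posDef {X : Type*} [TopologicalSpace X] {A : X → Matrix n n ℂ} {x : X}
    (hA : ContinuousAt A x) (hh : ∀ᶠ y in 𝓝 x, (A y).IsHermitian) (hx : (A x).PosDef) :
    ∀ᶠ y in 𝓝 x, (A y).PosDef := by
  have h : Ioi (0:ℝ) ∈ 𝓝ˢ (spectrum ℝ (A x)) := by
    rw [isOpen_Ioi.mem_nhdsSet, hx.isHermitian.spectrum_real_eq_range_eigenvalues]
    rintro _ ⟨i, rfl⟩
    exact hx.eigenvalues_pos i
  have := (upperHemicontinuous_spectrum ℝ (Matrix n n ℂ)).upperHemicontinuousAt (A x) _ h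
  filter_upwards [hA.eventually this, hh] with y hy hy'
  rw [hy'.posDef_iff_eigenvalues_pos]
  intro i
  exact subset_of_mem_nhdsSet hy (hy'.eigenvalues_mem_spectrum_real i)

omit [DecidableEq n] in
theorem isClosed_posSemidef : IsClosed {A : Matrix n n ℂ | A.PosSemidef} := by
  simp only [posSemidef_iff_dotProduct_mulVec, ofPred_and, ofPred_forall]
  refine IsClosed.inter (isClosed_eq (by fun_prop) (by fun_prop)) (isClosed_iInter fun v => ?_)
  exact isClosed_le (by fun_prop) (by fun_prop)

theorem hasDerivAt_dd {f : ℝ → ℝ} {a : ℝ} (hf : DifferentiableAt ℝ f a) {c : ℝ} (hac : a ≠ c) :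
    HasDerivAt (fun t => dd f t c) ((deriv f a - dd f a c) / (a - c)) a := by
  have h1 : HasDerivAt (fun t => (f t - f c) / (t - c))
      ((deriv f a * (a - c) - (f a - f c) * 1) / (a - c) ^ 2) a :=
    ((hf.hasDerivAt.sub_const _).div ((hasDerivAt_id a).sub_const c) (sub_ne_zero.mpr hac))
  have h2 : (fun t => dd f t c) =ᶠ[𝓝 a] fun t => (f t - f c) / (t - c) := by
    filter_upwards [isOpen_ne.mem_nhds hac] with t ht
    exact if_neg ht
  refine (h1.congr_of_eventuallyEq h2).congr_deriv ?_
  have := sub_ne_zero.mpr hac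
  rw [dd, if_neg hac]
  field_simp

theorem dd_comm (f : ℝ → ℝ) (a b : ℝ) : dd f a b = dd f b a := by
  by_cases h : a = b
  · rw [h]
  · rw [dd, dd, if_neg h, if_neg (Ne.symm h), ← neg_sub, ← neg_sub b a, neg_div_neg_eq]

theorem dd_dd {f : ℝ → ℝ} {a b c : ℝ} (hf : DifferentiableAt ℝ f a) (ha : a ≠ c) (hb : b ≠ c) :
    dd (fun t => dd f t c) b a = (dd f b a - dd f c a) / (b - c) := by
  by_cases hab : b = a
  · subst hab
    rw [dd, if_pos rfl, (hasDerivAt_dd hf hb).deriv, dd_comm f c b]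
    simp [dd]
  · have h1 := sub_ne_zero.mpr ha
    have h2 := sub_ne_zero.mpr hb
    have h3 := sub_ne_zero.mpr hab
    rw [dd_comm f c a, dd, if_neg hab]
    simp only [dd, if_neg hab, if_neg ha, if_neg hb]
    field_simp
    ring

theorem continuousOn_dd {f : ℝ → ℝ} {s : Set ℝ} (hs : IsOpen s) (hf : ContinuousOn f s) {c : ℝ}
    (hc : DifferentiableAt ℝ f c) : ContinuousOn (fun t => dd f t c) s := by
  intro a ha
  refine ContinuousAt.continuousWithinAt ?_
  by_cases hac : a = c
  · subst hac
    have h := hasDerivAt_iff_tendsto_slope.mp hc.hasDerivAt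
    rw [continuousAt_iff_punctured_nhds]
    have : dd f a a = deriv f a := if_pos rfl
    rw [this]
    refine h.congr' ?_
    filter_upwards [self_mem_nhdsWithin] with t ht
    exact (slope_def_field _ _ _).trans (if_neg ht).symm
  · have h2 : (fun t => (f t - f c) / (t - c)) =ᶠ[𝓝 a] fun t => dd f t c := by
      filter_upwards [isOpen_ne.mem_nhds hac] with t ht
      exact (if_neg ht).symm
    refine ContinuousAt.congr ?_ h2
    exact ((hf.continuousAt (hs.mem_nhds ha)).sub continuousAt_const).div
      (continuousAt_id.sub continuousAt_const) (sub_ne_zero.mpr hac)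

theorem commute_cfc (F : ℝ → ℝ) {A : Matrix n n ℂ} (hA : A.IsHermitian) :
    Commute A (cfc F A) := by
  have hA' : IsSelfAdjoint A := hA
  have h : Commute (cfc (fun t : ℝ => t) A) (cfc F A) := cfc_commute_cfc (fun t : ℝ => t) F A
  rwa [cfc_id' ℝ A] at h

theorem MatConvexOn.posSemidef_midpoint {m : ℕ} {f : ℝ → ℝ} (hf : MatConvexOn m (Ioi 0) f)
    {A B : Matrix (Fin m) (Fin m) ℂ} (hA : A.PosDef) (hB : B.PosDef) :
    ((1 / 2 : ℝ) • (cfc f A + cfc f B) - cfc f ((1 / 2 : ℝ) • (A + B))).PosSemidef := by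
  have key : ((1 / 2 : ℝ) : ℂ) • A + (1 - ((1 / 2 : ℝ) : ℂ)) • B = (1 / 2 : ℝ) • (A + B) := by
    ext i j
    simp only [Matrix.add_apply, Matrix.smul_apply, smul_eq_mul, Complex.real_smul]
    push_cast
    ring
  have hC : (((1 / 2 : ℝ) : ℂ) • A + (1 - ((1 / 2 : ℝ) : ℂ)) • B).IsHermitian := by
    rw [key]
    exact (hA.isHermitian.add hB.isHermitian).smul (IsSelfAdjoint.all (1 / 2 : ℝ))
  have h := hf A B hA.isHermitian hB.isHermitian (1 / 2) ⟨by norm_num, by norm_num⟩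
    hA.eigenvalues_pos hB.eigenvalues_pos hC
  rw [← hC.cfc_eq, ← hA.isHermitian.cfc_eq, ← hB.isHermitian.cfc_eq, key] at h
  convert h using 2
  ext i j
  simp only [Matrix.add_apply, Matrix.smul_apply, smul_eq_mul, Complex.real_smul]
  push_cast
  ring

omit [Fintype n] in
theorem posDef_diagonal_ofReal {l : n → ℝ} (hl : ∀ i, 0 < l i) :
    (diagonal fun i => (l i : ℂ)).PosDef :=
  PosDef.diagonal fun i => by simpa using hl i

theorem tendsto_cfc_add_smul {F : ℝ → ℝ} (hF : ContinuousOn F (Ioi 0)) {A K : Matrix n n ℂ}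
    (hA : A.PosDef) (hK : K.IsHermitian) :
    Tendsto (fun e : ℝ => cfc F (A + e • K)) (𝓝[≠] 0) (𝓝 (cfc F A)) := by
  have hc : Continuous fun e : ℝ => A + e • K := by fun_prop
  have hev : ∀ᶠ e : ℝ in 𝓝 0, (A + e • K).PosDef := by
    refine eventually_posDef hc.continuousAt (.of_forall fun e => ?_) (by simpa using hA)
    exact hA.isHermitian.add (hK.smul (IsSelfAdjoint.all e))
  have h := continuousOn_cfc_posDef hF (s := {e : ℝ | (A + e • K).PosDef}) hc.continuousOn
    fun _ h => h
  have := (h.continuousAt hev).tendsto.mono_left (nhdsWithin_le_nhds (s := {0}ᶜ))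
  simpa using this

theorem tendsto_cfc_corner {f : ℝ → ℝ} (hf : ContinuousOn f (Ioi 0)) {m : ℕ}
    (hd : ∀ t ∈ Ioi (0:ℝ), DifferentiableAt ℝ f t) {L : Fin (m + 1) → ℝ} (hL : ∀ i, 0 < L i)
    (hne : ∀ i, i ≠ 0 → L i ≠ L 0) {H : Matrix (Fin (m + 1)) (Fin (m + 1)) ℂ}
    (hH : H = of fun i k => if i = 0 ↔ k = 0 then 0 else 1) (i k : Fin (m + 1)) (hi : i ≠ 0)
    (hk : k ≠ 0) :
    Tendsto (fun e : ℝ => (e ^ 2)⁻¹ • (cfc f ((diagonal fun i => (L i : ℂ)) + e • H) -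
      cfc f (diagonal fun i => (L i : ℂ))) i k) (𝓝[≠] 0)
      (𝓝 (dd (fun t => dd f t (L 0)) (L k) (L i) : ℝ)) := by
  have hHh : H.IsHermitian := by
    subst hH
    ext a b
    by_cases ha : a = 0 <;> by_cases hb : b = 0 <;> simp [ha, hb]
  set X : Matrix (Fin (m + 1)) (Fin (m + 1)) ℂ := diagonal fun i => (L i : ℂ) with hX
  set G : ℝ → ℝ := fun t => dd f t (L i) with hG
  have hYh : ∀ e : ℝ, (X + e • H).IsHermitian := fun e =>
    (isHermitian_diagonal_ofReal L).add (hHh.smul (IsSelfAdjoint.all e))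
  have hC : Tendsto (fun e : ℝ => cfc G (X + e • H)) (𝓝[≠] 0)
      (𝓝 (diagonal fun i => (G (L i) : ℂ))) := by
    rw [← cfc_diagonal]
    exact tendsto_cfc_add_smul (continuousOn_dd isOpen_Ioi hf (hd _ (hL i)))
      (posDef_diagonal_ofReal hL) hHh
  have h0k : (L 0 : ℂ) - L k ≠ 0 := by
    rw [sub_ne_zero]
    exact_mod_cast (hne k hk).symm
  have hlim : Tendsto (fun e : ℝ => ((cfc G (X + e • H) * H) 0 k - (H * cfc G (X + e • H)) 0 k) /
      ((L 0 : ℂ) - L k)) (𝓝[≠] 0) (𝓝 (dd (fun t => dd f t (L 0)) (L k) (L i) : ℝ)) := by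
    have hv : ((dd (fun t => dd f t (L 0)) (L k) (L i) : ℝ) : ℂ) =
        (((diagonal fun i => (G (L i) : ℂ)) * H) 0 k - (H * diagonal fun i => (G (L i) : ℂ)) 0 k) /
          ((L 0 : ℂ) - L k) := by
      rw [dd_dd (hd _ (hL i)) (hne i hi) (hne k hk), diagonal_mul, mul_diagonal, hH]
      simp [hk, hG]
      rw [← neg_sub, ← neg_sub (L 0 : ℂ), neg_div_neg_eq]
    rw [hv]
    refine Tendsto.div_const (Tendsto.sub ?_ ?_) _
    · exact ((continuous_id.mul continuous_const).matrix_elem 0 k).continuousAt.tendsto.comp hC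
    · exact ((continuous_const.mul continuous_id).matrix_elem 0 k).continuousAt.tendsto.comp hC
  refine hlim.congr' ?_
  filter_upwards [self_mem_nhdsWithin] with e he
  have he : (e : ℂ) ≠ 0 := by exact_mod_cast he
  rw [cfc_diagonal_add_apply f L hHh e i k, ← hX]
  have hrow : (H * cfc G (X + e • H)) i k = cfc G (X + e • H) 0 k := by
    rw [mul_apply, Finset.sum_eq_single 0]
    · simp [hH, hi]
    · intro b _ hb
      simp [hH, hi, hb]
    · simp
  have hcomm : (X + e • H) * cfc G (X + e • H) = cfc G (X + e • H) * (X + e • H) := by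
    exact commute_cfc G (hYh e)
  have h := congr_fun (congr_fun hcomm 0) k
  rw [hrow]
  generalize cfc G (X + e • H) = C at h ⊢
  simp only [add_mul, mul_add, smul_mul, mul_smul_comm, Matrix.add_apply, hX, diagonal_mul,
    mul_diagonal, Matrix.smul_apply, Complex.real_smul, Complex.ofReal_inv, Complex.ofReal_pow]
    at h ⊢
  field_simp
  linear_combination (-1 : ℂ) * h

/-- The Loewner matrix of the divided difference of an operator convex function. -/
theorem posSemidef_loewner {f : ℝ → ℝ} (hf : ∀ n, MatConvexOn n (Ioi 0) f)
    (hd : ∀ t ∈ Ioi (0:ℝ), DifferentiableAt ℝ f t) {t₀ : ℝ} (ht₀ : 0 < t₀) {m : ℕ}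
    {l : Fin m → ℝ} (hl : ∀ i, 0 < l i) (hne : ∀ i, l i ≠ t₀) :
    (of fun i k => ((dd (fun t => dd f t t₀) (l k) (l i) : ℝ) : ℂ)).PosSemidef := by
  set L : Fin (m + 1) → ℝ := Fin.cons t₀ l with hLdef
  have hL : ∀ i, 0 < L i := Fin.cases ht₀ hl
  have hneL : ∀ i, i ≠ 0 → L i ≠ L 0 := by
    intro i
    induction i using Fin.cases with
    | zero => simp
    | succ i => simpa [hLdef] using hne i
  have hcont : ContinuousOn f (Ioi 0) := fun t ht => (hd t ht).continuousAt.continuousWithinAt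
  set H : Matrix (Fin (m + 1)) (Fin (m + 1)) ℂ :=
    of fun i k => if i = 0 ↔ k = 0 then 0 else 1 with hH
  have hHh : H.IsHermitian := by
    ext a b
    by_cases ha : a = 0 <;> by_cases hb : b = 0 <;> simp [hH, ha, hb]
  set X : Matrix (Fin (m + 1)) (Fin (m + 1)) ℂ := diagonal fun i => (L i : ℂ) with hX
  have hneg : Tendsto (fun e : ℝ => -e) (𝓝[≠] 0) (𝓝[≠] 0) := by
    refine tendsto_nhdsWithin_iff.mpr ⟨?_, ?_⟩
    · simpa using (continuous_neg (G := ℝ)).continuousAt.tendsto.mono_left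
        (nhdsWithin_le_nhds (a := (0:ℝ)) (s := {0}ᶜ))
    · filter_upwards [self_mem_nhdsWithin] with e he
      simpa using he
  have hev : ∀ᶠ e : ℝ in 𝓝[≠] 0, (X + e • H).PosDef := by
    refine nhdsWithin_le_nhds (eventually_posDef (by fun_prop) (.of_forall fun e => ?_)
      (by rw [zero_smul, add_zero]; exact posDef_diagonal_ofReal hL))
    exact (isHermitian_diagonal_ofReal L).add (hHh.smul (IsSelfAdjoint.all e))
  have hev' := hneg.eventually hev
  change _ ∈ {A : Matrix (Fin m) (Fin m) ℂ | A.PosSemidef}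
  refine isClosed_posSemidef.mem_of_tendsto (b := 𝓝[≠] (0:ℝ)) (f := fun e : ℝ =>
    (((e ^ 2)⁻¹ : ℝ) • ((1 / 2 : ℝ) • (cfc f (X + e • H) + cfc f (X + (-e) • H)) -
      cfc f X)).submatrix Fin.succ Fin.succ) ?_ ?_
  · refine tendsto_pi_nhds.mpr fun i => tendsto_pi_nhds.mpr fun k => ?_
    have h := tendsto_cfc_corner hcont hd hL hneL hH i.succ k.succ (Fin.succ_ne_zero i)
      (Fin.succ_ne_zero k)
    have h' := (h.add (h.comp hneg)).const_mul (1 / 2 : ℂ)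
    convert h' using 2
    · simp
      ring
    · simp [hLdef]
      ring
  · filter_upwards [hev, hev'] with e h1 h2
    have h := (hf (m + 1)).posSemidef_midpoint h1 h2
    have hmid : (1 / 2 : ℝ) • (X + e • H + (X + -e • H)) = X := by
      ext i j
      simp
      ring
    rw [hmid] at h
    exact (h.smul (by positivity)).submatrix _

theorem tendsto_smul_cfc_diagonal {g : ℝ → ℝ} (hg : ContinuousOn g (Ioi 0)) {l : n → ℝ}
    (hl : ∀ i, 0 < l i) (hd : ∀ i, DifferentiableAt ℝ g (l i)) {K : Matrix n n ℂ}
    (hK : K.IsHermitian) :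
    Tendsto (fun e : ℝ => e⁻¹ • (cfc g ((diagonal fun i => (l i : ℂ)) + e • K) -
      cfc g (diagonal fun i => (l i : ℂ)))) (𝓝[≠] 0)
      (𝓝 (K ⊙ of fun i k => (dd g (l k) (l i) : ℂ))) := by
  refine tendsto_pi_nhds.mpr fun i => tendsto_pi_nhds.mpr fun k => ?_
  have h := tendsto_cfc_add_smul (continuousOn_dd isOpen_Ioi hg (hd i))
    (posDef_diagonal_ofReal hl) hK
  rw [cfc_diagonal] at h
  have hcont : Continuous fun C : Matrix n n ℂ => (K * C) i k :=
    (continuous_const.mul continuous_id).matrix_elem i k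
  have h2 := hcont.continuousAt.tendsto.comp h
  have hv : (K * diagonal fun j => (dd g (l j) (l i) : ℂ)) i k =
      (K ⊙ of fun i k => (dd g (l k) (l i) : ℂ)) i k := by
    rw [mul_diagonal]; rfl
  rw [hv] at h2
  refine h2.congr' ?_
  filter_upwards [self_mem_nhdsWithin] with e he
  have he : (e : ℂ) ≠ 0 := by exact_mod_cast he
  rw [Matrix.smul_apply, cfc_diagonal_add_apply g l hK e i k, Complex.real_smul,
    Complex.ofReal_inv, inv_mul_cancel_left₀ he]
  rfl

theorem continuous_conjStarAlgAut (u : unitary (Matrix n n ℂ)) :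
    Continuous (Unitary.conjStarAlgAut ℂ (Matrix n n ℂ) u) := by
  change Continuous fun x => Unitary.conjStarAlgAut ℂ _ u x
  simp only [Unitary.conjStarAlgAut_apply]
  fun_prop

theorem cfc_conjStarAlgAut (F : ℝ → ℝ) (u : unitary (Matrix n n ℂ)) {A : Matrix n n ℂ}
    (hA : A.IsHermitian) :
    cfc F (Unitary.conjStarAlgAut ℂ _ u A) = Unitary.conjStarAlgAut ℂ _ u (cfc F A) := by
  have hA' : IsSelfAdjoint A := hA
  exact (StarAlgHomClass.map_cfc (S := ℂ) (Unitary.conjStarAlgAut ℂ (Matrix n n ℂ) u) F A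
    (continuousOn_spectrum _ _) (continuous_conjStarAlgAut u)
    hA' (hA'.map _)).symm

/-- The divided difference of an operator convex function has positive semidefinite derivatives
in positive semidefinite directions. -/
theorem exists_posSemidef_tendsto {f : ℝ → ℝ} (hf : ∀ n, MatConvexOn n (Ioi 0) f)
    (hd : ∀ t ∈ Ioi (0:ℝ), DifferentiableAt ℝ f t) {t₀ : ℝ} (ht₀ : 0 < t₀) {m : ℕ}
    {A K : Matrix (Fin m) (Fin m) ℂ} (hA : A.PosDef) (hK : K.PosSemidef)
    (hne : t₀ ∉ spectrum ℝ A) :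
    ∃ D : Matrix (Fin m) (Fin m) ℂ, D.PosSemidef ∧
      Tendsto (fun e : ℝ => e⁻¹ • (cfc (fun t => dd f t t₀) (A + e • K) -
        cfc (fun t => dd f t t₀) A)) (𝓝[≠] 0) (𝓝 D) := by
  set g : ℝ → ℝ := fun t => dd f t t₀ with hg
  set l := hA.isHermitian.eigenvalues with hl
  set u := hA.isHermitian.eigenvectorUnitary
  set φ := Unitary.conjStarAlgAut ℂ (Matrix (Fin m) (Fin m) ℂ) u with hφ
  have hlpos : ∀ i, 0 < l i := hA.eigenvalues_pos
  have hlne : ∀ i, l i ≠ t₀ := fun i h =>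
    hne (h ▸ hA.isHermitian.eigenvalues_mem_spectrum_real i)
  have hcont : ContinuousOn f (Ioi 0) := fun t ht => (hd t ht).continuousAt.continuousWithinAt
  have hφc : Continuous φ := continuous_conjStarAlgAut u
  obtain ⟨K', rfl⟩ : ∃ K', φ K' = K := ⟨φ.symm K, φ.apply_symm_apply K⟩
  have hφpsd : ∀ D : Matrix (Fin m) (Fin m) ℂ, (φ D).PosSemidef ↔ D.PosSemidef := by
    intro D
    rw [hφ, Unitary.conjStarAlgAut_apply]
    exact IsUnit.posSemidef_star_right_conjugate_iff (Unitary.isUnit_coe (U := u))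
  rw [hφpsd] at hK
  have hAeq : A = φ (diagonal fun i => (l i : ℂ)) := hA.isHermitian.spectral_theorem
  refine ⟨φ (K' ⊙ of fun i k => (dd g (l k) (l i) : ℂ)), ?_, ?_⟩
  · rw [hφpsd]
    exact hK.hadamard (posSemidef_loewner hf hd ht₀ hlpos hlne)
  · have h := tendsto_smul_cfc_diagonal (continuousOn_dd isOpen_Ioi hcont (hd t₀ ht₀)) hlpos
      (fun i => (hasDerivAt_dd (hd _ (hlpos i)) (hlne i)).differentiableAt) hK.isHermitian
    refine (hφc.continuousAt.tendsto.comp h).congr fun e => ?_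
    have hsm : ∀ M : Matrix (Fin m) (Fin m) ℂ, ∀ r : ℝ, φ (r • M) = r • φ M := by
      intro M r
      have := map_smul φ (r : ℂ) M
      simpa using this
    have hY : ((diagonal fun i => (l i : ℂ)) + e • K').IsHermitian :=
      (isHermitian_diagonal_ofReal l).add (hK.isHermitian.smul (IsSelfAdjoint.all e))
    simp only [Function.comp_apply]
    rw [hsm, map_sub, hφ, ← cfc_conjStarAlgAut _ _ hY,
      ← cfc_conjStarAlgAut _ _ (isHermitian_diagonal_ofReal l), ← hφ, map_add, hsm, ← hAeq]

theorem le_of_hasDerivAt_nonneg_off_finset {ψ : ℝ → ℝ} (S : Finset ℝ) {a b : ℝ} (hab : a ≤ b)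
    (hc : ContinuousOn ψ (Icc a b))
    (hd : ∀ x ∈ Ioo a b, x ∉ S → ∃ d, 0 ≤ d ∧ HasDerivAt ψ d x) : ψ a ≤ ψ b := by
  induction S using Finset.induction_on generalizing a b with
  | empty =>
    have : MonotoneOn ψ (Icc a b) := by
      refine monotoneOn_of_deriv_nonneg (convex_Icc a b) hc ?_ ?_
      · intro x hx
        rw [interior_Icc] at hx
        obtain ⟨d, -, h⟩ := hd x hx (by simp)
        exact h.differentiableAt.differentiableWithinAt
      · intro x hx
        rw [interior_Icc] at hx
        obtain ⟨d, h0, h⟩ := hd x hx (by simp)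
        rwa [h.deriv]
    exact this (left_mem_Icc.mpr hab) (right_mem_Icc.mpr hab) hab
  | insert c S _ ih =>
    by_cases h : c ∈ Ioo a b
    · refine (ih h.1.le (hc.mono (Icc_subset_Icc_right h.2.le)) fun x hx hxS => ?_).trans
        (ih h.2.le (hc.mono (Icc_subset_Icc_left h.1.le)) fun x hx hxS => ?_)
      · exact hd x ⟨hx.1, hx.2.trans h.2⟩ (by simp [hxS, hx.2.ne])
      · exact hd x ⟨h.1.trans hx.1, hx.2⟩ (by simp [hxS, hx.1.ne'])
    · refine ih hab hc fun x hx hxS => hd x hx ?_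
      simp only [Finset.mem_insert, not_or]
      exact ⟨fun hxc => h (hxc ▸ hx), hxS⟩

theorem isHermitian_cfc (F : ℝ → ℝ) (A : Matrix n n ℂ) : (cfc F A).IsHermitian :=
  (cfc_predicate F A : IsSelfAdjoint (cfc F A))

theorem finite_setOf_mem_spectrum_add_smul {A : Matrix n n ℂ} (K : Matrix n n ℂ) {c : ℝ}
    (hc : c ∉ spectrum ℝ A) : {s : ℝ | c ∈ spectrum ℝ (A + s • K)}.Finite := by
  set N : Matrix n n ℂ := algebraMap ℝ _ c - A with hN
  set p : Polynomial ℂ :=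
    (N.map Polynomial.C - (Polynomial.X : Polynomial ℂ) • K.map Polynomial.C).det with hp
  have heval : ∀ s : ℝ, p.eval (s : ℂ) = (algebraMap ℝ _ c - (A + s • K)).det := by
    intro s
    rw [hp, ← Polynomial.coe_evalRingHom, RingHom.map_det]
    congr 1
    ext i j
    simp [hN]
    ring
  have hmem : ∀ s : ℝ, c ∈ spectrum ℝ (A + s • K) ↔ p.eval (s : ℂ) = 0 := by
    intro s
    rw [spectrum.mem_iff, Matrix.isUnit_iff_isUnit_det, isUnit_iff_ne_zero, not_not, heval]
  have hp0 : p ≠ 0 := by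
    intro h
    have := (hmem 0).mpr (by simp [h])
    simp at this
    exact hc this
  have : {s : ℝ | c ∈ spectrum ℝ (A + s • K)} ⊆ Complex.ofReal ⁻¹' {z | p.IsRoot z} := by
    intro s hs
    exact (hmem s).mp hs
  exact ((Polynomial.finite_setOfPred_isRoot hp0).preimage
    Complex.ofReal_injective.injOn).subset this

theorem posSemidef_cfc_sub_of_notMem {f : ℝ → ℝ} (hf : ∀ n, MatConvexOn n (Ioi 0) f)
    (hd : ∀ t ∈ Ioi (0:ℝ), DifferentiableAt ℝ f t) {t₀ : ℝ} (ht₀ : 0 < t₀) {m : ℕ}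
    {A K : Matrix (Fin m) (Fin m) ℂ} (hA : A.PosDef) (hK : K.PosSemidef)
    (hne : t₀ ∉ spectrum ℝ A) :
    (cfc (fun t => dd f t t₀) (A + K) - cfc (fun t => dd f t t₀) A).PosSemidef := by
  set g : ℝ → ℝ := fun t => dd f t t₀ with hg
  have hcont : ContinuousOn f (Ioi 0) := fun t ht => (hd t ht).continuousAt.continuousWithinAt
  have hgc : ContinuousOn g (Ioi 0) := continuousOn_dd isOpen_Ioi hcont (hd t₀ ht₀)
  have hpos : ∀ s : ℝ, 0 ≤ s → (A + s • K).PosDef := fun s hs => hA.add_posSemidef (hK.smul hs)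
  refine PosSemidef.of_dotProduct_mulVec_nonneg ((isHermitian_cfc _ _).sub (isHermitian_cfc _ _))
    fun v => ?_
  set q : Matrix (Fin m) (Fin m) ℂ → ℝ := fun M => (star v ⬝ᵥ M *ᵥ v).re with hq
  have hqc : Continuous q := by fun_prop
  have hqsub : ∀ M N, q (M - N) = q M - q N := fun M N => by
    simp [hq, sub_mulVec, dotProduct_sub]
  have hqsm : ∀ (r : ℝ) M, q (r • M) = r * q M := fun r M => by
    simp [hq, smul_mulVec, dotProduct_smul]
  have hle : q (cfc g (A + (0:ℝ) • K)) ≤ q (cfc g (A + (1:ℝ) • K)) := by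
    refine le_of_hasDerivAt_nonneg_off_finset (ψ := fun s : ℝ => q (cfc g (A + s • K)))
      (finite_setOf_mem_spectrum_add_smul K hne).toFinset zero_le_one ?_ ?_
    · exact hqc.comp_continuousOn
        (continuousOn_cfc_posDef hgc (by fun_prop) fun s hs => hpos s hs.1)
    · intro s hs hsne
      simp only [Finite.mem_toFinset, mem_ofPred_eq] at hsne
      obtain ⟨D, hD, hlim⟩ := exists_posSemidef_tendsto hf hd ht₀ (hpos s hs.1.le) hK hsne
      refine ⟨q D, (Complex.nonneg_iff.mp (hD.dotProduct_mulVec_nonneg v)).1, ?_⟩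
      rw [hasDerivAt_iff_tendsto_slope_zero]
      refine (hqc.continuousAt.tendsto.comp hlim).congr fun e => ?_
      simp only [Function.comp_apply, hqsm, hqsub, smul_eq_mul, add_smul, add_assoc]
      rfl
  rw [zero_smul, add_zero, one_smul] at hle
  rw [Complex.nonneg_iff]
  refine ⟨?_, ?_⟩
  · have := sub_nonneg.mpr hle
    rwa [← hqsub] at this
  · exact (((isHermitian_cfc _ _).sub (isHermitian_cfc _ _)).im_star_dotProduct_mulVec_self v).symm

theorem posSemidef_cfc_sub {f : ℝ → ℝ} (hf : ∀ n, MatConvexOn n (Ioi 0) f)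
    (hd : ∀ t ∈ Ioi (0:ℝ), DifferentiableAt ℝ f t) {t₀ : ℝ} (ht₀ : 0 < t₀) {m : ℕ}
    {A K : Matrix (Fin m) (Fin m) ℂ} (hA : A.PosDef) (hK : K.PosSemidef) :
    (cfc (fun t => dd f t t₀) (A + K) - cfc (fun t => dd f t t₀) A).PosSemidef := by
  set g : ℝ → ℝ := fun t => dd f t t₀ with hg
  have hcont : ContinuousOn f (Ioi 0) := fun t ht => (hd t ht).continuousAt.continuousWithinAt
  have hgc : ContinuousOn g (Ioi 0) := continuousOn_dd isOpen_Ioi hcont (hd t₀ ht₀)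
  have h1 : (1 : Matrix (Fin m) (Fin m) ℂ).IsHermitian := isHermitian_one
  have hlim := ((tendsto_cfc_add_smul hgc (hA.add_posSemidef hK) h1).sub
    (tendsto_cfc_add_smul hgc hA h1)).mono_left
    (nhdsWithin_mono 0 (s := Ioi 0) fun e he => ne_of_gt he)
  refine isClosed_posSemidef.mem_of_tendsto hlim ?_
  have hfin : ∀ᶠ e : ℝ in 𝓝[≠] 0, t₀ - e ∉ spectrum ℝ A := by
    have hF : ((fun e : ℝ => t₀ - e) ⁻¹' spectrum ℝ A).Finite :=
      A.finite_real_spectrum.preimage (sub_right_injective).injOn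
    have : ∀ᶠ e : ℝ in 𝓝[≠] 0, e ∈ ((fun e : ℝ => t₀ - e) ⁻¹' spectrum ℝ A)ᶜ := by
      have := (hF.subset (sdiff_subset (t := {0}))).isClosed.isOpen_compl.mem_nhds
        (x := (0:ℝ)) (by simp)
      filter_upwards [nhdsWithin_le_nhds this, self_mem_nhdsWithin] with e he he0 h
      exact he ⟨h, he0⟩
    exact this
  filter_upwards [hfin.filter_mono (nhdsWithin_mono 0 (s := Ioi 0) fun e he => ne_of_gt he),
    self_mem_nhdsWithin] with e he he0
  have hpd : (A + e • (1 : Matrix (Fin m) (Fin m) ℂ)).PosDef :=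
    hA.add_posSemidef (PosSemidef.one.smul (le_of_lt he0))
  have hns : t₀ ∉ spectrum ℝ (A + e • (1 : Matrix (Fin m) (Fin m) ℂ)) := by
    rw [← Algebra.algebraMap_eq_smul_one, spectrum.mem_iff]
    rw [spectrum.mem_iff, map_sub] at he
    convert he using 3
    abel
  have := posSemidef_cfc_sub_of_notMem hf hd ht₀ hpd hK hns
  rwa [add_right_comm] at this

theorem MatConvexOn.convexOn {f : ℝ → ℝ} (hf : MatConvexOn 1 (Ioi 0) f) :
    ConvexOn ℝ (Ioi 0) f := by
  refine ⟨convex_Ioi 0, fun a ha b hb s r hs hr hsr => ?_⟩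
  obtain rfl : r = 1 - s := by linarith
  have hdiag : ∀ c : ℝ, 0 < c → (diagonal fun _ : Fin 1 => (c : ℂ)).PosDef := fun c hc =>
    posDef_diagonal_ofReal (l := fun _ => c) fun _ => hc
  have hA := hdiag a ha
  have hB := hdiag b hb
  have heq : (s : ℂ) • (diagonal fun _ : Fin 1 => (a : ℂ)) +
      ((1 : ℂ) - (s : ℂ)) • (diagonal fun _ : Fin 1 => (b : ℂ)) =
      diagonal fun _ : Fin 1 => ((s * a + (1 - s) * b : ℝ) : ℂ) := by
    ext i j
    simp [Subsingleton.elim i j]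
  have hC : ((s : ℂ) • (diagonal fun _ : Fin 1 => (a : ℂ)) +
      ((1 : ℂ) - (s : ℂ)) • (diagonal fun _ : Fin 1 => (b : ℂ))).IsHermitian := by
    rw [heq]
    exact isHermitian_diagonal_ofReal _
  have h := hf _ _ hA.isHermitian hB.isHermitian s ⟨hs, by linarith⟩ hA.eigenvalues_pos
    hB.eigenvalues_pos hC
  rw [← hC.cfc_eq, ← hA.isHermitian.cfc_eq, ← hB.isHermitian.cfc_eq, heq, cfc_diagonal,
    cfc_diagonal, cfc_diagonal] at h
  have h0 := h.diag_nonneg (i := 0)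
  simp only [Matrix.sub_apply, Matrix.add_apply, Matrix.smul_apply, diagonal_apply_eq,
    smul_eq_mul] at h0
  have h1 : 0 ≤ s * f a + (1 - s) * f b - f (s * a + (1 - s) * b) := by exact_mod_cast h0
  simp only [smul_eq_mul]
  linarith

theorem cfc_mulVec_of_mulVec_eq_smul (F : ℝ → ℝ) {A : Matrix n n ℂ} (hA : A.IsHermitian) {c : ℝ}
    {v : n → ℂ} (hv : A *ᵥ v = c • v) : cfc F A *ᵥ v = F c • v := by
  have hcomm := (commute_cfc (fun t => dd F t c) hA).sub_left
    (Algebra.commutes c (cfc (fun t => dd F t c) A) : Commute _ _)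
  have h0 : (A - algebraMap ℝ _ c) *ᵥ v = 0 := by
    rw [sub_mulVec, hv, Algebra.algebraMap_eq_smul_one, smul_mulVec, one_mulVec, sub_self]
  rw [cfc_eq_add_sub_mul F c hA, hcomm.eq, add_mulVec, ← mulVec_mulVec, h0, mulVec_zero, add_zero,
    Algebra.algebraMap_eq_smul_one, smul_mulVec, one_mulVec]

theorem cfc_fin_two_apply_zero_zero (F : ℝ → ℝ) {A : Matrix (Fin 2) (Fin 2) ℂ}
    (hA : A.IsHermitian) {p q a b : ℝ} (hpq : p ^ 2 + q ^ 2 ≠ 0)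
    (ha : A *ᵥ ![(p : ℂ), q] = a • ![(p : ℂ), q]) (hb : A *ᵥ ![(q : ℂ), -p] = b • ![(q : ℂ), -p]) :
    cfc F A 0 0 = ((p ^ 2 * F a + q ^ 2 * F b) / (p ^ 2 + q ^ 2) : ℝ) := by
  have h1 := congr_fun (cfc_mulVec_of_mulVec_eq_smul F hA ha) 0
  have h2 := congr_fun (cfc_mulVec_of_mulVec_eq_smul F hA hb) 0
  simp [mulVec, dotProduct, Fin.sum_univ_two] at h1 h2
  have hpq' : (p : ℂ) ^ 2 + (q : ℂ) ^ 2 ≠ 0 := by exact_mod_cast hpq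
  push_cast
  rw [eq_div_iff hpq']
  linear_combination (p : ℂ) * h1 + (q : ℂ) * h2

/-- Midpoint convexity at two explicit `2 × 2` matrices, read off in a diagonal entry. -/
theorem MatConvexOn.four_point {f : ℝ → ℝ} (hf : MatConvexOn 2 (Ioi 0) f) {t e : ℝ} (ht : 0 < t)
    (he : 0 ≤ e) (het : 50 * e < t) :
    4 / 5 * f (t + 15 * e) + 1 / 5 * f (t - 15 * e) ≤
      1 / 2 * (9 / 25 * f (t + 50 * e) + 16 / 25 * f t + f t) := by
  set A : Matrix (Fin 2) (Fin 2) ℂ := (Matrix.diagonal fun _ => (t : ℂ)) +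
    (2 * e) • vecMulVec ![3, 4] (star ![3, 4]) with hA
  set B : Matrix (Fin 2) (Fin 2) ℂ := Matrix.diagonal fun i => ((![t, t - 50 * e] i : ℝ) : ℂ) with hB
  have hAp : A.PosDef :=
    (posDef_diagonal_ofReal (l := fun _ => t) fun _ => ht).add_posSemidef
      ((posSemidef_vecMulVec_self_star _).smul (by positivity))
  have hBp : B.PosDef := posDef_diagonal_ofReal fun i => by
    fin_cases i
    · exact ht
    · simpa using het
  have h := (hf.posSemidef_midpoint hAp hBp).diag_nonneg (i := 0)
  have hCh : ((1 / 2 : ℝ) • (A + B)).IsHermitian :=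
    (hAp.isHermitian.add hBp.isHermitian).smul (IsSelfAdjoint.all (1 / 2 : ℝ))
  have eA := cfc_fin_two_apply_zero_zero f hAp.isHermitian (p := 3) (q := 4) (a := t + 50 * e)
    (b := t) (by norm_num)
    (by ext i; fin_cases i <;>
      simp [hA, mulVec, dotProduct, Fin.sum_univ_two, vecMulVec, map_ofNat] <;> ring)
    (by ext i; fin_cases i <;>
      simp [hA, mulVec, dotProduct, Fin.sum_univ_two, vecMulVec, map_ofNat] <;> ring)
  have eC := cfc_fin_two_apply_zero_zero f hCh (p := 2) (q := 1) (a := t + 15 * e)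
    (b := t - 15 * e) (by norm_num)
    (by ext i; fin_cases i <;>
      simp [hA, hB, mulVec, dotProduct, Fin.sum_univ_two, vecMulVec, map_ofNat] <;> ring)
    (by ext i; fin_cases i <;>
      simp [hA, hB, mulVec, dotProduct, Fin.sum_univ_two, vecMulVec, map_ofNat] <;> ring)
  rw [Matrix.sub_apply, Matrix.smul_apply, Matrix.add_apply, eA, eC, hB, cfc_diagonal,
    diagonal_apply_eq, Complex.real_smul] at h
  have h' : 0 ≤ 1 / 2 * ((3 ^ 2 * f (t + 50 * e) + 4 ^ 2 * f t) / (3 ^ 2 + 4 ^ 2) + f t) -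
      (2 ^ 2 * f (t + 15 * e) + 1 ^ 2 * f (t - 15 * e)) / (2 ^ 2 + 1 ^ 2) := by
    exact_mod_cast h
  linarith

theorem differentiableAt_of_matConvexOn {f : ℝ → ℝ} (hf : ∀ n, MatConvexOn n (Ioi 0) f) {t : ℝ}
    (ht : 0 < t) : DifferentiableAt ℝ f t := by
  have hconv := (hf 1).convexOn
  have hti : t ∈ interior (Ioi (0:ℝ)) := by simpa using ht
  have hR := hconv.hasDerivWithinAt_rightDeriv_of_mem_interior hti
  have hL := hconv.hasDerivWithinAt_leftDeriv_of_mem_interior hti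
  have hle := hconv.leftDeriv_le_rightDeriv_of_mem_interior hti
  generalize derivWithin f (Ioi t) t = R at hR hle
  generalize derivWithin f (Iio t) t = L at hL hle
  have hright : ∀ c : ℝ, 0 < c →
      HasDerivWithinAt (fun e => f (t + c * e)) (R * (c * 1)) (Ioi 0) 0 := by
    intro c hc
    have h1 : HasDerivWithinAt (fun e : ℝ => t + c * e) (c * 1) (Ioi 0) 0 :=
      (((hasDerivAt_id 0).const_mul c).const_add t).hasDerivWithinAt
    refine HasDerivWithinAt.comp (s' := Ioi t) (0:ℝ) (by simpa using hR) h1 fun e he => ?_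
    have := mul_pos hc he
    simpa using this
  have hleft : HasDerivWithinAt (fun e => f (t - 15 * e)) (L * (-(15 * 1))) (Ioi 0) 0 := by
    have h1 : HasDerivWithinAt (fun e : ℝ => t - 15 * e) (-(15 * 1)) (Ioi 0) 0 :=
      (((hasDerivAt_id 0).const_mul 15).const_sub t).hasDerivWithinAt
    refine HasDerivWithinAt.comp (s' := Iio t) (0:ℝ) (by simpa using hL) h1 fun e he => ?_
    simpa using he
  set φ : ℝ → ℝ := fun e => 1 / 2 * (9 / 25 * f (t + 50 * e) + 16 / 25 * f t + f t) -
    (4 / 5 * f (t + 15 * e) + 1 / 5 * f (t - 15 * e)) with hφ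
  have hD : HasDerivWithinAt φ (1 / 2 * (9 / 25 * (R * (50 * 1))) -
      (4 / 5 * (R * (15 * 1)) + 1 / 5 * (L * (-(15 * 1))))) (Ioi 0) 0 :=
    (((((hright 50 (by norm_num)).const_mul (9 / 25)).add_const _).add_const _).const_mul _).sub
      (((hright 15 (by norm_num)).const_mul _).add (hleft.const_mul _))
  have hge : 0 ≤ 1 / 2 * (9 / 25 * (R * (50 * 1))) -
      (4 / 5 * (R * (15 * 1)) + 1 / 5 * (L * (-(15 * 1)))) := by
    rw [hasDerivWithinAt_iff_tendsto_slope' (by simp)] at hD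
    refine ge_of_tendsto hD ?_
    have hsmall : ∀ᶠ e : ℝ in 𝓝[>] 0, e < t / 50 :=
      nhdsWithin_le_nhds (Iio_mem_nhds (by positivity))
    filter_upwards [hsmall, self_mem_nhdsWithin] with e he he0
    have he0 : 0 < e := he0
    have hp := (hf 2).four_point ht he0.le (by linarith)
    have h0 : φ 0 = 0 := by simp [hφ]; ring
    rw [slope_def_field, h0, sub_zero, sub_zero]
    exact div_nonneg (sub_nonneg.mpr hp) he0.le
  obtain rfl : L = R := by linarith
  have h := (hasDerivWithinAt_Iio_iff_Iic.mp hL).union (hasDerivWithinAt_Ioi_iff_Ici.mp hR)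
  rw [Iic_union_Ici, hasDerivWithinAt_univ] at h
  exact h.differentiableAt

end

theorem stmt9 (f : ℝ → ℝ) (hf : ∀ n, MatConvexOn n (Ioi 0) f) :
    (∀ t ∈ Ioi (0:ℝ), DifferentiableAt ℝ f t) ∧
    ∀ t₀ ∈ Ioi (0:ℝ), ∀ n, MatMonoOn n (Ioi 0) (fun t => dd f t t₀) := by
  have hd : ∀ t ∈ Ioi (0:ℝ), DifferentiableAt ℝ f t := fun t ht =>
    differentiableAt_of_matConvexOn hf ht
  refine ⟨hd, fun t₀ ht₀ n A B hA hB hAp _ hAB => ?_⟩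
  have h := posSemidef_cfc_sub hf hd ht₀ (hA.posDef_iff_eigenvalues_pos.mpr hAp) hAB
  rwa [add_sub_cancel, hA.cfc_eq, hB.cfc_eq] at h

end
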